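/- Let 𝒳 and 𝒜 be finite nonempty sets and let w_{a|x} (a ∈ 𝒜, x ∈ 𝒳) be Hermitian d×d matrices such that for every function f : 𝒳 → 𝒜 the matrix ∑_{x∈𝒳} w_{f(x)|x} is positive semidefinite. Then every bipartite assemblage σ_{a|x} admitting an LHS model satisfies the steering-witness inequality ∑_{a∈𝒜, x∈𝒳} Tr[ w_{a|x} σ_{a|x} ] ≥ 0. Consequently, any assemblage for which this quantity is negative is steerable. -/

import Mathlib

open Matrix BigOperators ComplexOrder

noncomputable section

/-- The trace of the product of two positive semidefinite complex matrices is nonnegative. -/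
theorem trace_mul_nonneg_of_posSemidef {m : Type*} [Fintype m]
    {A B : Matrix m m ℂ} (hA : A.PosSemidef) (hB : B.PosSemidef) : 0 ≤ (A * B).trace := by
  obtain ⟨k, v, rfl⟩ := Matrix.posSemidef_iff_eq_sum_vecMulVec.mp hB
  rw [Finset.mul_sum, Matrix.trace_sum]
  refine Finset.sum_nonneg fun i _ => ?_
  rw [Matrix.mul_vecMulVec, Matrix.trace_vecMulVec, dotProduct_comm]
  exact hA.dotProduct_mulVec_nonneg (v i)

/-- The trace of the product of two Hermitian complex matrices is real. -/
theorem ofReal_re_trace_mul_of_isHermitian {m : Type*} [Fintype m]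
    {A B : Matrix m m ℂ} (hA : A.IsHermitian) (hB : B.IsHermitian) :
    (((A * B).trace.re : ℝ) : ℂ) = (A * B).trace := by
  refine Complex.conj_eq_iff_re.mp ?_
  rw [starRingEnd_apply, ← Matrix.trace_conjTranspose, Matrix.conjTranspose_mul, hA.eq, hB.eq,
    Matrix.trace_mul_comm]

/-- If `g` has nonnegative total value on every deterministic strategy, it also has
nonnegative total value on every stochastic one. -/
theorem sum_stochastic_nonneg_of_deterministic {X A : Type*} [Fintype X] [Fintype A] [Nonempty A]
    (g : A → X → ℝ) (hg : ∀ f : X → A, 0 ≤ ∑ x, g (f x) x)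
    (q : A → X → ℝ) (hq : ∀ a x, 0 ≤ q a x) (hqsum : ∀ x, ∑ a, q a x = 1) :
    0 ≤ ∑ a, ∑ x, q a x * g a x := by
  choose f hf using fun x => Finite.exists_min (fun a => g a x)
  rw [Finset.sum_comm]
  refine (hg f).trans (Finset.sum_le_sum fun x _ => ?_)
  calc g (f x) x = ∑ a, q a x * g (f x) x := by rw [← Finset.sum_mul, hqsum, one_mul]
    _ ≤ ∑ a, q a x * g a x :=
      Finset.sum_le_sum fun a _ => mul_le_mul_of_nonneg_left (hf x a) (hq a x)

/-- A steering witness: if for every deterministic strategy `f` the matrix `∑_x w_{f(x)|x}`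
is positive semidefinite, then every LHS assemblage yields a nonnegative (real) value of
`∑_{a,x} Tr[w_{a|x} σ_{a|x}]`. -/
theorem steering_witness_nonneg_on_LHS
    (𝒳 𝒜 : Type) [Fintype 𝒳] [Fintype 𝒜] [DecidableEq 𝒳] [DecidableEq 𝒜]
    [Nonempty 𝒳] [Nonempty 𝒜] (d : ℕ)
    (w : 𝒜 → 𝒳 → Matrix (Fin d) (Fin d) ℂ)
    (hherm : ∀ a x, (w a x).IsHermitian)
    (hwit : ∀ f : 𝒳 → 𝒜, (∑ x, w (f x) x).PosSemidef)
    (σ : 𝒜 → 𝒳 → Matrix (Fin d) (Fin d) ℂ)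
    (hpsd : ∀ a x, (σ a x).PosSemidef)
    (hnorm : ∀ x, ∑ a, (σ a x).trace = 1)
    (n : ℕ) (P : Fin n → ℝ) (q : Fin n → 𝒜 → 𝒳 → ℝ)
    (ϱ : Fin n → Matrix (Fin d) (Fin d) ℂ)
    (hP : ∀ l, 0 ≤ P l) (hPsum : ∑ l, P l = 1)
    (hq : ∀ l a x, 0 ≤ q l a x) (hqsum : ∀ l x, ∑ a, q l a x = 1)
    (hϱ : ∀ l, (ϱ l).PosSemidef ∧ (ϱ l).trace = 1)
    (hσ : ∀ a x, σ a x = ∑ l, (P l * q l a x) • ϱ l) :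
    ∃ r : ℝ, 0 ≤ r ∧ (∑ a : 𝒜, ∑ x : 𝒳, (w a x * σ a x).trace) = (r : ℂ) := by
  refine ⟨∑ l, P l * ∑ a, ∑ x, q l a x * (w a x * ϱ l).trace.re, ?_, ?_⟩
  · refine Finset.sum_nonneg fun l _ => mul_nonneg (hP l) ?_
    refine sum_stochastic_nonneg_of_deterministic _ (fun f => ?_) (q l) (hq l) (hqsum l)
    rw [← Complex.re_sum, ← Matrix.trace_sum, ← Finset.sum_mul]
    exact (Complex.nonneg_iff.mp (trace_mul_nonneg_of_posSemidef (hwit f) (hϱ l).1)).1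
  · push_cast
    simp_rw [ofReal_re_trace_mul_of_isHermitian (hherm _ _) (hϱ _).1.isHermitian, Finset.mul_sum]
    rw [eq_comm, Finset.sum_comm]
    refine Finset.sum_congr rfl fun a _ => ?_
    rw [Finset.sum_comm]
    refine Finset.sum_congr rfl fun x _ => ?_
    simp [hσ, Finset.mul_sum, Matrix.trace_sum, mul_assoc]
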